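/- arXiv:1203.5622 — 3 statements merged into one kernel-verified Lean document; each statement's English description precedes it below -/
import Mathlib

section
/- Every uniformly pyramidal polytope is a simplex: if P is a polytope such that for every facet B of P there exists a point a ∈ P with P equal to the convex hull of B ∪ {a}, then the set of extreme points of P is affinely independent. -/
open Set

variable {V : Type*} [NormedAddCommGroup V] [NormedSpace ℝ V] [FiniteDimensional ℝ V]

/-- `F` is a face of the convex set `C`. -/
def IsFace (C F : Set V) : Prop :=
  F.Nonempty ∧ Convex ℝ F ∧ F ⊆ C ∧
    ∀ x ∈ C, ∀ y ∈ C, ∀ α : ℝ, 0 < α → α < 1 → α • x + (1 - α) • y ∈ F → x ∈ F ∧ y ∈ F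

/-- The dimension of a subset of a vector space: the dimension of its affine hull. -/
noncomputable def setDim (s : Set V) : ℕ := Module.finrank ℝ (affineSpan ℝ s).direction

/-- Given a finite set `S` of vectors there is a functional bounded by `1` on `S` whose tight vectors
span all of `S`. -/
theorem exists_dual_le_one_subset_span_tight {E : Type*} [AddCommGroup E] [Module ℝ E]
    {S : Set E} (hS : S.Finite) :
    ∃ f : E →ₗ[ℝ] ℝ, (∀ s ∈ S, f s ≤ 1) ∧ S ⊆ Submodule.span ℝ {s ∈ S | f s = 1} := by
  classical
  have hfin : {T : Set E | ∃ f : E →ₗ[ℝ] ℝ, (∀ s ∈ S, f s ≤ 1) ∧ {s ∈ S | f s = 1} = T}.Finite := by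
    refine hS.finite_subsets.subset ?_
    rintro T ⟨f, -, rfl⟩
    exact fun s hs => hs.1
  obtain ⟨T, ⟨f, hf, rfl⟩, hmax⟩ := hfin.exists_maximal ⟨_, 0, by simp, rfl⟩
  refine ⟨f, hf, fun s₀ hs₀ => ?_⟩
  by_contra hns
  obtain ⟨g, hg, hgT⟩ : ∃ g : E →ₗ[ℝ] ℝ, 0 < g s₀ ∧ ∀ s ∈ S, f s = 1 → g s = 0 := by
    obtain ⟨g, hg, hgT⟩ := Submodule.exists_le_ker_of_notMem hns
    have hgT' : ∀ s ∈ S, f s = 1 → g s = 0 := fun s hs h1 =>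
      hgT (Submodule.subset_span ⟨hs, h1⟩)
    rcases lt_or_gt_of_ne hg with h | h
    · exact ⟨-g, by simpa using h, fun s hs h1 => by simp [hgT' s hs h1]⟩
    · exact ⟨g, h, hgT'⟩
  obtain ⟨s₁, ⟨hs₁, hg₁⟩, hmin⟩ := (hS.subset (sep_subset S fun s => 0 < g s)).exists_minimalFor
    (fun s => (1 - f s) / g s) _ ⟨s₀, hs₀, hg⟩
  have hmin' : ∀ s ∈ S, 0 < g s → (1 - f s₁) / g s₁ ≤ (1 - f s) / g s := fun s hs h =>
    (le_total _ _).elim id fun h' => hmin ⟨hs, h⟩ h'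
  have ht : 0 ≤ (1 - f s₁) / g s₁ := div_nonneg (sub_nonneg.2 (hf s₁ hs₁)) hg₁.le
  set t := (1 - f s₁) / g s₁ with htdef
  have htight : (f + t • g) s₁ = 1 := by
    simp only [LinearMap.add_apply, LinearMap.smul_apply, smul_eq_mul, htdef]
    field_simp
    ring
  have hle : ∀ s ∈ S, (f + t • g) s ≤ 1 := by
    intro s hs
    simp only [LinearMap.add_apply, LinearMap.smul_apply, smul_eq_mul]
    rcases le_or_gt (g s) 0 with h | h
    · nlinarith [hf s hs]
    · have := (le_div_iff₀ h).1 (hmin' s hs h)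
      linarith
  have hsub := hmax ⟨f + t • g, hle, rfl⟩ fun s hs =>
    ⟨hs.1, by simp [hs.2, hgT s hs.1 hs.2]⟩
  have h1 : f s₁ = 1 := (hsub ⟨hs₁, htight⟩ : s₁ ∈ {s ∈ S | f s = 1}).2
  exact hg₁.ne' (hgT s₁ hs₁ h1)

/-- The points where a linear functional attains a maximal value form a face. -/
theorem isFace_sep_eq_of_le {E : Type*} [NormedAddCommGroup E] [NormedSpace ℝ E] {P : Set E}
    (hP : Convex ℝ P) (f : E →ₗ[ℝ] ℝ) {c : ℝ} (hle : ∀ x ∈ P, f x ≤ c) (hne : ∃ x ∈ P, f x = c) :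
    IsFace P {x ∈ P | f x = c} := by
  refine ⟨hne, hP.inter (convex_hyperplane f.isLinear c), fun x hx => hx.1, ?_⟩
  rintro x hx y hy α h0 h1 ⟨-, h⟩
  simp only [map_add, map_smul, smul_eq_mul] at h
  have hx' := hle x hx
  have hy' := hle y hy
  refine ⟨⟨hx, le_antisymm hx' ?_⟩, ⟨hy, le_antisymm hy' ?_⟩⟩ <;> nlinarith

/-- A set contained in a hyperplane that does not contain `e`, but spanning `P` together with `e`,
has dimension one less than `P`. -/
theorem setDim_add_one_eq {P B : Set V} {e b : V} (f : V →ₗ[ℝ] ℝ) (he : e ∈ P) (hBP : B ⊆ P)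
    (hb : b ∈ B) (hf : ∀ x ∈ B, f (x - e) = 1)
    (hspan : vectorSpan ℝ P ≤ Submodule.span ℝ ((fun x => x - e) '' B)) :
    setDim B + 1 = setDim P := by
  have hker : vectorSpan ℝ B ≤ LinearMap.ker f := by
    refine Submodule.span_le.2 ?_
    rintro _ ⟨x, hx, y, hy, rfl⟩
    have hx' := hf x hx
    have hy' := hf y hy
    simp only [map_sub, vsub_eq_sub, SetLike.mem_coe, LinearMap.mem_ker] at *
    linarith
  have hsup : vectorSpan ℝ B ⊔ Submodule.span ℝ {b - e} = vectorSpan ℝ P := by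
    refine le_antisymm (sup_le (vectorSpan_mono ℝ hBP) ?_) (hspan.trans (Submodule.span_le.2 ?_))
    · rw [Submodule.span_singleton_le_iff_mem]
      exact vsub_mem_vectorSpan ℝ (hBP hb) he
    · rintro _ ⟨x, hx, rfl⟩
      have hsum := Submodule.add_mem_sup (vsub_mem_vectorSpan ℝ hx hb)
        (Submodule.mem_span_singleton_self (R := ℝ) (b - e))
      simpa using hsum
  have hinf : vectorSpan ℝ B ⊓ Submodule.span ℝ {b - e} = ⊥ := by
    refine (Submodule.eq_bot_iff _).2 fun x hx => ?_
    obtain ⟨c, rfl⟩ := Submodule.mem_span_singleton.1 hx.2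
    have h0 : f (c • (b - e)) = 0 := hker hx.1
    rw [map_smul, hf b hb, smul_eq_mul, mul_one] at h0
    simp [h0]
  have hne : b - e ≠ 0 := fun h => by simpa [h] using hf b hb
  have hdim := Submodule.finrank_sup_add_finrank_inf_eq (vectorSpan ℝ B) (Submodule.span ℝ {b - e})
  rw [hsup, hinf, finrank_bot, finrank_span_singleton hne] at hdim
  rw [setDim, setDim, direction_affineSpan, direction_affineSpan]
  omega

/-- If every point of a family is separated from all the others by a hyperplane containing the
others, the family is affinely independent. -/
theorem affineIndependent_of_forall_exists_dual {E ι : Type*} [AddCommGroup E] [Module ℝ E]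
    {p : ι → E} (h : ∀ i, ∃ f : E →ₗ[ℝ] ℝ, ∀ j, j ≠ i → f (p j - p i) = 1) :
    AffineIndependent ℝ p := by
  classical
  rw [affineIndependent_iff]
  intro s w hw hp i hi
  obtain ⟨f, hf⟩ := h i
  have hzero : ∑ j ∈ s, w j * f (p j - p i) = 0 := by
    have := congrArg f hp
    simp only [map_sum, map_smul, smul_eq_mul, map_zero] at this
    simp only [map_sub, mul_sub, Finset.sum_sub_distrib, this, ← Finset.sum_mul, hw]
    simp
  rw [← Finset.add_sum_erase _ _ hi] at hzero hw
  rw [Finset.sum_congr rfl fun j hj => by rw [hf j (Finset.ne_of_mem_erase hj), mul_one]] at hzero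
  simp only [sub_self, map_zero, mul_zero, zero_add] at hzero
  linarith

/-- Every uniformly pyramidal polytope is a simplex: if `P` is a polytope
such that for every facet `B` of `P` there is a point `a ∈ P` with `P = conv (B ∪ {a})`,
then the set of extreme points of `P` is affinely independent. -/
theorem uniformly_pyramidal_polytope_is_simplex
    (P : Set V) (hcpt : IsCompact P) (hconv : Convex ℝ P)
    (hfin : (Set.extremePoints ℝ P).Finite)
    (hpyr : ∀ B : Set V, IsFace P B → setDim B + 1 = setDim P →
      ∃ a ∈ P, P = convexHull ℝ (B ∪ {a})) :
    AffineIndependent ℝ (fun e : Set.extremePoints ℝ P => (e : V)) := by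
  have hP : P = convexHull ℝ (extremePoints ℝ P) := by
    rw [← (hfin.isClosed_convexHull ℝ).closure_eq]
    exact (closure_convexHull_extremePoints hcpt hconv).symm
  refine affineIndependent_of_forall_exists_dual ?_
  rintro ⟨e, he⟩
  obtain ⟨f, hf, hspan⟩ :=
    exists_dual_le_one_subset_span_tight ((hfin.sdiff (t := {e})).image fun x => x - e)
  refine ⟨f, ?_⟩
  rintro ⟨x, hx⟩ hxe
  replace hxe : x ≠ e := fun h => hxe (Subtype.ext h)
  obtain ⟨b, hb, hfb⟩ : ∃ b ∈ extremePoints ℝ P, f b = 1 + f e := by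
    by_contra! hcon
    have hempty : {s ∈ (fun x => x - e) '' (extremePoints ℝ P \ {e}) | f s = 1} = ∅ := by
      refine eq_empty_of_forall_notMem ?_
      rintro _ ⟨⟨y, hy, rfl⟩, h⟩
      refine hcon y hy.1 ?_
      simp only [map_sub] at h
      linarith
    rw [hempty, Submodule.span_empty] at hspan
    exact hxe (sub_eq_zero.1 (by simpa using hspan ⟨x, ⟨hx, hxe⟩, rfl⟩))
  have hle : ∀ y ∈ P, f y ≤ 1 + f e := by
    have hsub : convexHull ℝ (extremePoints ℝ P) ⊆ {y | f y ≤ 1 + f e} := by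
      refine convexHull_min (fun y hy => ?_) (convex_halfSpace_le f.isLinear _)
      by_cases hye : y = e
      · simp [hye]
      · have := hf _ ⟨y, ⟨hy, hye⟩, rfl⟩
        simp only [map_sub] at this
        simp only [mem_ofPred_eq]
        linarith
    exact fun y hy => hsub (hP ▸ hy)
  have hfB : ∀ y ∈ {y ∈ P | f y = 1 + f e}, f (y - e) = 1 := fun y hy => by
    rw [map_sub, hy.2, add_sub_cancel_right]
  have hspanP : vectorSpan ℝ P ≤
      Submodule.span ℝ ((fun y => y - e) '' {y ∈ P | f y = 1 + f e}) := by
    rw [← direction_affineSpan, hP, affineSpan_convexHull, direction_affineSpan, ← hP,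
      vectorSpan_eq_span_vsub_set_right_ne ℝ he]
    refine (Submodule.span_le.2 hspan).trans (Submodule.span_mono ?_)
    rintro _ ⟨⟨y, hy, rfl⟩, h⟩
    refine ⟨y, ⟨hy.1.1, ?_⟩, rfl⟩
    simp only [map_sub] at h
    linarith
  obtain ⟨a, -, ha⟩ := hpyr _ (isFace_sep_eq_of_le hconv f hle ⟨b, hb.1, hfb⟩)
    (setDim_add_one_eq f he.1 (sep_subset _ _) ⟨hb.1, hfb⟩ hfB hspanP)
  have hcases : ∀ y ∈ extremePoints ℝ P, y ∈ {y ∈ P | f y = 1 + f e} ∪ {a} := fun y hy =>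
    extremePoints_convexHull_subset (ha ▸ hy)
  have hea : e = a := (hcases e he).resolve_left fun h => by simpa using h.2
  exact hfB x ((hcases x hx).resolve_right fun h => hxe (h.trans hea.symm))
end

section
/- Let P be a polytope in a finite-dimensional real vector space V and let F be a nonempty convex subset of P. Then: (i) if F is a proper face of P, there exist a linear functional f : V → ℝ and k ∈ ℝ such that f(v) ≤ k for all v ∈ P and F = {v ∈ P : f(v) = k}; (ii) conversely, if there exist a linear functional f : V → ℝ and k ∈ ℝ with f(v) ≤ k for all v ∈ P and F = {v ∈ P : f(v) = k}, then F is a face of P. -/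
open Set

variable {V : Type*} [NormedAddCommGroup V] [NormedSpace ℝ V] [FiniteDimensional ℝ V]

open Topology in
/-- A face contains every point of the ambient convex set lying in its affine span. -/
theorem IsFace.mem_of_mem_affineSpan {C F : Set V} (hF : IsFace C F) {x : V} (hxC : x ∈ C)
    (hx : x ∈ affineSpan ℝ F) : x ∈ F := by
  obtain ⟨hne, hconv, hsub, hface⟩ := hF
  obtain ⟨_, q, hq, rfl⟩ := (intrinsicInterior_nonempty hconv).2 hne
  let g : ℝ → affineSpan ℝ F := fun t =>
    ⟨AffineMap.lineMap (q : V) x t, AffineMap.lineMap_mem t q.2 hx⟩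
  have hg : Continuous g := AffineMap.lineMap_continuous.subtype_mk _
  have hg0 : g 0 = q := Subtype.ext (AffineMap.lineMap_apply_zero _ _)
  have hmem : ∀ᶠ t in 𝓝 (0 : ℝ), (g t : V) ∈ F := by
    have h := hg.continuousAt.preimage_mem_nhds (x := (0 : ℝ))
      (by rw [hg0]; exact mem_interior_iff_mem_nhds.1 hq)
    exact h
  obtain ⟨t, htF, ht⟩ :=
    ((hmem.filter_mono nhdsWithin_le_nhds).and (self_mem_nhdsWithin (s := Iio (0 : ℝ)))).exists
  have ht : t < 0 := ht
  have h1 : 0 < 1 - t := by linarith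
  refine (hface _ (hsub htF) x hxC (1 - t)⁻¹ (inv_pos.2 h1) (inv_lt_one_of_one_lt₀ (by linarith))
    ?_).2
  have hqF : (q : V) ∈ F := interior_subset (s := ((↑) ⁻¹' F : Set (affineSpan ℝ F))) hq
  convert hqF using 1
  simp only [g, AffineMap.lineMap_apply_module]
  match_scalars <;> field_simp
  ring

theorem IsFace.isExtreme {E : Type*} [NormedAddCommGroup E] [NormedSpace ℝ E] {C F : Set E}
    (hF : IsFace C F) : IsExtreme ℝ C F := by
  obtain ⟨-, -, hsub, hface⟩ := hF
  refine ⟨hsub, ?_⟩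
  rintro x hx y hy _ hz ⟨a, b, ha, hb, hab, rfl⟩
  obtain rfl : b = 1 - a := by linarith
  exact (hface x hx y hy a ha (by linarith) hz).1

/-- The part of a convex set lying in a supporting hyperplane is a face. -/
theorem Convex.isFace_of_forall_le {E : Type*} [NormedAddCommGroup E] [NormedSpace ℝ E]
    {C : Set E} (hC : Convex ℝ C) {f : E →ₗ[ℝ] ℝ} {k : ℝ}
    (hle : ∀ v ∈ C, f v ≤ k) (hne : {v ∈ C | f v = k}.Nonempty) :
    IsFace C {v ∈ C | f v = k} := by
  refine ⟨hne, hC.inter (convex_hyperplane f.isLinear k), fun _ hv => hv.1, ?_⟩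
  rintro x hx y hy a ha ha' ⟨-, h⟩
  simp only [map_add, map_smul, smul_eq_mul] at h
  have hfx := hle x hx
  have hfy := hle y hy
  exact ⟨⟨hx, by nlinarith⟩, ⟨hy, by nlinarith⟩⟩

/-- A linear functional bounded above on the affine span of a set is constant on the set. -/
theorem eq_of_forall_mem_affineSpan_lt {E : Type*} [AddCommGroup E] [Module ℝ E] {s : Set E}
    {f : E →ₗ[ℝ] ℝ} {u : ℝ} (hf : ∀ v ∈ affineSpan ℝ s, f v < u) {a b : E} (ha : a ∈ s) (hb : b ∈ s) :
    f a = f b := by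
  by_contra hab
  have hab' : f b - f a ≠ 0 := sub_ne_zero.2 (Ne.symm hab)
  have h := hf _ (AffineMap.lineMap_mem ((u - f a) / (f b - f a))
    (subset_affineSpan ℝ s ha) (subset_affineSpan ℝ s hb))
  rw [AffineMap.lineMap_apply_module'] at h
  simp only [map_add, map_smul, map_sub, smul_eq_mul] at h
  rw [div_mul_cancel₀ _ hab'] at h
  linarith

/-- Every face of a polytope is cut out by a supporting hyperplane. -/
theorem IsFace.exists_eq_setOf_eq {P F : Set V} (hF : IsFace P F) (hcpt : IsCompact P)
    (hconv : Convex ℝ P) (hfin : (extremePoints ℝ P).Finite) :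
    ∃ (f : V →ₗ[ℝ] ℝ) (k : ℝ), (∀ v ∈ P, f v ≤ k) ∧ F = {v ∈ P | f v = k} := by
  have hP : convexHull ℝ (extremePoints ℝ P) = P := by
    rw [← (hfin.isClosed_convexHull ℝ).closure_eq, closure_convexHull_extremePoints hcpt hconv]
  have hK : convexHull ℝ (extremePoints ℝ P \ F) ⊆ P \ F :=
    convexHull_min (sdiff_subset_sdiff_left extremePoints_subset)
      (hF.isExtreme.convex_sdiff hconv)
  have hdisj : Disjoint (affineSpan ℝ F : Set V) (convexHull ℝ (extremePoints ℝ P \ F)) :=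
    disjoint_left.2 fun x hx hx' => (hK hx').2 (hF.mem_of_mem_affineSpan (hK hx').1 hx)
  obtain ⟨f, u, w, hu, huw, hw⟩ := geometric_hahn_banach_closed_compact
    (affineSpan ℝ F).convex (AffineSubspace.closed_of_finiteDimensional _)
    (convex_convexHull ℝ _) (hfin.sdiff.isCompact_convexHull ℝ) hdisj
  obtain ⟨p, hp⟩ := hF.1
  have hfF : ∀ v ∈ F, f v = f p := fun v hv =>
    eq_of_forall_mem_affineSpan_lt (f := (f : V →ₗ[ℝ] ℝ)) hu hv hp
  have hfp : f p < u := hu p (subset_affineSpan ℝ F hp)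
  have hunion : Convex ℝ (F ∪ {v | f p < f v}) := by
    have hlt {x y : V} {a b : ℝ} (ha : 0 < a) (hb : 0 < b) (hab : a + b = 1)
        (hx : f p ≤ f x) (hy : f p < f y) : f p < f (a • x + b • y) := by
      simp only [map_add, map_smul, smul_eq_mul]
      obtain rfl : a = 1 - b := by linarith
      nlinarith
    refine convex_iff_forall_pos.2 ?_
    rintro x (hx | hx) y (hy | hy) a b ha hb hab
    · exact Or.inl (hF.2.1 hx hy ha.le hb.le hab)
    · exact Or.inr (hlt ha hb hab (hfF x hx).ge hy)
    · rw [add_comm]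
      exact Or.inr (hlt hb ha (by linarith) (hfF y hy).ge hx)
    · exact Or.inr (hlt ha hb hab (le_of_lt hx) hy)
  have hPsub : P ⊆ F ∪ {v | f p < f v} := by
    rw [← hP]
    refine convexHull_min (fun v hv => ?_) hunion
    by_cases hvF : v ∈ F
    · exact Or.inl hvF
    · exact Or.inr ((hfp.trans huw).trans (hw v (subset_convexHull ℝ _ ⟨hv, hvF⟩)))
  refine ⟨-(f : V →ₗ[ℝ] ℝ), -f p, fun v hv => ?_, Subset.antisymm (fun v hv => ?_) ?_⟩
  · rcases hPsub hv with h | h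
    · simp [hfF v h]
    · simpa using le_of_lt h
  · exact ⟨hF.2.2.1 hv, by simp [hfF v hv]⟩
  · rintro v ⟨hv, hvk⟩
    refine (hPsub hv).resolve_right fun (h : f p < f v) => h.ne' ?_
    simpa using hvk

/-- For a nonempty convex subset `F` of a polytope `P`:
(i) if `F` is a proper face of `P`, then it is the intersection of `P` with a supporting
hyperplane; (ii) conversely, any intersection of `P` with a supporting hyperplane is a face. -/
theorem proper_face_iff_supporting_hyperplane
    (P : Set V) (hcpt : IsCompact P) (hconv : Convex ℝ P)
    (hfin : (Set.extremePoints ℝ P).Finite)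
    (F : Set V) (hFne : F.Nonempty) (hFconv : Convex ℝ F) (hFP : F ⊆ P) :
    ((IsFace P F ∧ F ≠ P) →
      ∃ (f : V →ₗ[ℝ] ℝ) (k : ℝ), (∀ v ∈ P, f v ≤ k) ∧ F = {v ∈ P | f v = k}) ∧
    ((∃ (f : V →ₗ[ℝ] ℝ) (k : ℝ), (∀ v ∈ P, f v ≤ k) ∧ F = {v ∈ P | f v = k}) →
      IsFace P F) := by
  refine ⟨fun h => h.1.exists_eq_setOf_eq hcpt hconv hfin, ?_⟩
  rintro ⟨f, k, hle, rfl⟩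
  exact hconv.isFace_of_forall_le hle hFne
end

section
/- Let P be a polytope of dimension d that is a pyramid with base B and apex a, i.e. B is a polytope of dimension d − 1, a is a point with P = conv(B ∪ {a}). If F is a facet of B, then conv(F ∪ {a}) is a facet of P. -/
open Set

variable {V : Type*} [NormedAddCommGroup V] [NormedSpace ℝ V] [FiniteDimensional ℝ V]

/-- Adjoining a point outside the affine hull raises the dimension by one. -/
theorem setDim_convexHull_insert {s : Set V} (hs : s.Nonempty) {a : V}
    (ha : a ∉ affineSpan ℝ s) : setDim (convexHull ℝ (insert a s)) = setDim s + 1 := by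
  obtain ⟨b, hb⟩ := hs
  have hb' : b ∈ affineSpan ℝ s := subset_affineSpan ℝ s hb
  have hab : a -ᵥ b ∉ (affineSpan ℝ s).direction := fun h =>
    ha ((AffineSubspace.vsub_right_mem_direction_iff_mem hb' a).1 h)
  unfold setDim
  rw [affineSpan_convexHull, ← affineSpan_insert_affineSpan,
    AffineSubspace.direction_affineSpan_insert hb', sup_comm,
    Submodule.finrank_sup_span_singleton hab]

omit [FiniteDimensional ℝ V] in
/-- A point outside the affine hull of `s` is separated from `s` by a linear functional that is
constant on `s`. -/
theorem exists_linearMap_eq_on_ne_of_notMem_affineSpan {s : Set V} {a : V}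
    (ha : a ∉ affineSpan ℝ s) :
    ∃ (f : V →ₗ[ℝ] ℝ) (c : ℝ), (∀ b ∈ s, f b = c) ∧ f a ≠ c := by
  rcases s.eq_empty_or_nonempty with rfl | ⟨b, hb⟩
  · exact ⟨0, 1, by simp, by simp⟩
  have hb' : b ∈ affineSpan ℝ s := subset_affineSpan ℝ s hb
  have hab : a -ᵥ b ∉ (affineSpan ℝ s).direction := fun h =>
    ha ((AffineSubspace.vsub_right_mem_direction_iff_mem hb' a).1 h)
  obtain ⟨f, hfa, hf⟩ := Submodule.exists_le_ker_of_notMem hab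
  refine ⟨f, f b, fun x hx => ?_, fun h => hfa (by simp [h])⟩
  have h := hf (AffineSubspace.vsub_mem_direction (subset_affineSpan ℝ s hx) hb')
  simpa [sub_eq_zero] using h

omit [FiniteDimensional ℝ V] in
theorem mem_convexHull_insert_iff_of_convex {s : Set V} (hs : s.Nonempty) (hconv : Convex ℝ s)
    {a x : V} : x ∈ convexHull ℝ (insert a s) ↔
      ∃ b ∈ s, ∃ t : ℝ, 0 ≤ t ∧ t ≤ 1 ∧ x = (1 - t) • b + t • a := by
  rw [convexHull_insert hs, hconv.convexHull_eq, mem_convexJoin]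
  constructor
  · rintro ⟨_, rfl, b, hb, u, v, hu, hv, huv, rfl⟩
    refine ⟨b, hb, u, hu, by linarith, ?_⟩
    rw [← huv, add_sub_cancel_left, add_comm]
  · rintro ⟨b, hb, t, ht0, ht1, rfl⟩
    exact ⟨a, rfl, b, hb, t, 1 - t, ht0, by linarith, by ring, add_comm _ _⟩

omit [FiniteDimensional ℝ V] in
/-- The pyramid over a face of the base is a face of the pyramid over the base. -/
theorem IsFace.convexHull_insert {B F : Set V} (hB : Convex ℝ B) (hF : IsFace B F) {a : V}
    (ha : a ∉ affineSpan ℝ B) :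
    IsFace (convexHull ℝ (insert a B)) (convexHull ℝ (insert a F)) := by
  obtain ⟨hne, hconv, hFB, hface⟩ := hF
  have haF : a ∈ convexHull ℝ (insert a F) := subset_convexHull ℝ _ (mem_insert a F)
  refine ⟨⟨a, haF⟩, convex_convexHull ℝ _, convexHull_mono (insert_subset_insert hFB), ?_⟩
  intro x hx y hy α hα0 hα1 hxy
  rw [mem_convexHull_insert_iff_of_convex (hne.mono hFB) hB] at hx hy
  rw [mem_convexHull_insert_iff_of_convex hne hconv] at hxy
  obtain ⟨b, hb, s, hs0, hs1, rfl⟩ := hx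
  obtain ⟨c, hc, t, ht0, ht1, rfl⟩ := hy
  obtain ⟨d, hd, r, hr0, hr1, h⟩ := hxy
  have hr : r = α * s + (1 - α) * t := by
    obtain ⟨f, k, hf, hfa⟩ := exists_linearMap_eq_on_ne_of_notMem_affineSpan ha
    have hfh := congrArg f h
    simp only [map_add, map_smul, smul_eq_mul, hf b hb, hf c hc, hf d (hFB hd)] at hfh
    refine mul_right_cancel₀ (sub_ne_zero.2 hfa) ?_
    linear_combination -hfh
  have hbase : (1 - r) • d = (α * (1 - s)) • b + ((1 - α) * (1 - t)) • c := by
    have h' : (1 - r) • d = α • ((1 - s) • b + s • a) + (1 - α) • ((1 - t) • c + t • a)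
        - r • a := by rw [h, add_sub_cancel_right]
    rw [h', hr]
    module
  have hmem : ∀ e ∈ F, ∀ u : ℝ, 0 ≤ u → u ≤ 1 →
      (1 - u) • e + u • a ∈ convexHull ℝ (insert a F) := fun e he u hu0 hu1 =>
    (mem_convexHull_insert_iff_of_convex hne hconv).2 ⟨e, he, u, hu0, hu1, rfl⟩
  rcases hs1.eq_or_lt with rfl | hs1'
  · refine ⟨by simpa using haF, ?_⟩
    rcases ht1.eq_or_lt with rfl | ht1'
    · simpa using haF
    have hpos : (1 - α) * (1 - t) ≠ 0 := (mul_pos (by linarith) (by linarith)).ne'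
    have hdc : d = c := by
      refine smul_right_injective V hpos ?_
      have hr' : 1 - r = (1 - α) * (1 - t) := by rw [hr]; ring
      simpa [hr'] using hbase
    exact hmem c (hdc ▸ hd) t ht0 ht1
  rcases ht1.eq_or_lt with rfl | ht1'
  · refine ⟨?_, by simpa using haF⟩
    have hpos : α * (1 - s) ≠ 0 := (mul_pos hα0 (by linarith)).ne'
    have hdb : d = b := by
      refine smul_right_injective V hpos ?_
      have hr' : 1 - r = α * (1 - s) := by rw [hr]; ring
      simpa [hr'] using hbase
    exact hmem b (hdb ▸ hd) s hs0 hs1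
  have hp : 0 < α * (1 - s) := mul_pos hα0 (by linarith)
  have hq : 0 < (1 - α) * (1 - t) := mul_pos (by linarith) (by linarith)
  have hsum : 1 - r = α * (1 - s) + (1 - α) * (1 - t) := by rw [hr]; ring
  have hrpos : 0 < 1 - r := by linarith
  have hweight : 1 - α * (1 - s) / (1 - r) = (1 - α) * (1 - t) / (1 - r) := by
    rw [eq_div_iff hrpos.ne', sub_mul, div_mul_cancel₀ _ hrpos.ne']
    linarith
  have hd' : (α * (1 - s) / (1 - r)) • b + (1 - α * (1 - s) / (1 - r)) • c = d := by
    rw [hweight, div_eq_inv_mul, div_eq_inv_mul, mul_smul _ (α * _), mul_smul _ ((1 - α) * _), ← smul_add, ← hbase,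
      inv_smul_smul₀ hrpos.ne']
  obtain ⟨hbF, hcF⟩ := hface b hb c hc (α * (1 - s) / (1 - r)) (div_pos hp hrpos)
    ((div_lt_one hrpos).2 (by linarith)) (hd'.symm ▸ hd)
  exact ⟨hmem b hbF s hs0 hs1, hmem c hcF t ht0 ht1⟩

/-- Let `P` be a `d`-polytope which is a pyramid with base `B` (a
`(d-1)`-polytope) and apex `a`, i.e. `P = conv (B ∪ {a})`. If `F` is a facet of `B`, then
`conv (F ∪ {a})` is a facet of `P`. -/
theorem pyramid_facet
    (B : Set V) (hBcpt : IsCompact B) (hBconv : Convex ℝ B)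
    (hBfin : (Set.extremePoints ℝ B).Finite)
    (a : V) (P : Set V) (hP : P = convexHull ℝ (B ∪ {a}))
    (hdim : setDim B + 1 = setDim P)
    (F : Set V) (hF : IsFace B F) (hFdim : setDim F + 1 = setDim B) :
    IsFace P (convexHull ℝ (F ∪ {a})) ∧
      setDim (convexHull ℝ (F ∪ {a})) + 1 = setDim P := by
  subst hP
  rw [union_singleton] at hdim ⊢
  rw [union_singleton]
  have ha : a ∉ affineSpan ℝ B := fun h => by
    unfold setDim at hdim
    rw [affineSpan_convexHull, affineSpan_insert_eq_affineSpan ℝ h] at hdim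
    omega
  have haF : a ∉ affineSpan ℝ F := fun h => ha (affineSpan_mono ℝ hF.2.2.1 h)
  refine ⟨hF.convexHull_insert hBconv ha, ?_⟩
  rw [setDim_convexHull_insert hF.1 haF, hFdim, hdim]
end
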